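/- Let X = (x_1, …, x_n) be a finite nonempty family of points in ℝ^d, let C ⊂ ℝ^d be a finite nonempty set of centers, let 0 < ε ≤ 1, and let R ≥ 0 satisfy R² = (ε²/41)·Φ(C, X)/n. For each i, let c(x_i) ∈ C be a center of C nearest to x_i, and define y_i = c(x_i) if D(x_i, C) ≤ R and y_i = x_i otherwise; let m' = (1/n)∑_i y_i. If a point m'' ∈ ℝ^d satisfies ∑_{i=1}^n ‖y_i − m''‖² ≤ (1 + ε/16)·∑_{i=1}^n ‖y_i − m'‖², then ∑_{i=1}^n ‖x_i − m''‖² ≤ (1 + ε/2)·Δ(X). -/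

import Mathlib

open Classical

/-- The parallel axis identity for the sum of squared distances to a point. -/
theorem sum_norm_sub_sq_eq_add_centroid {E : Type*} [NormedAddCommGroup E]
    [InnerProductSpace ℝ E] {n : ℕ} (hn : 0 < n) (x : Fin n → E) (z : E) :
    ∑ i, ‖x i - z‖ ^ 2 = ∑ i, ‖x i - (n : ℝ)⁻¹ • ∑ j, x j‖ ^ 2 +
      n * ‖(n : ℝ)⁻¹ • ∑ j, x j - z‖ ^ 2 := by
  set μ := (n : ℝ)⁻¹ • ∑ j, x j with hμ
  have hn' : (n : ℝ) ≠ 0 := by positivity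
  have hsum : ∑ i, (x i - μ) = 0 := by
    rw [Finset.sum_sub_distrib, Finset.sum_const, Finset.card_univ, Fintype.card_fin,
      ← Nat.cast_smul_eq_nsmul ℝ, hμ, smul_inv_smul₀ hn', sub_self]
  have hpt : ∀ i, ‖x i - z‖ ^ 2 =
      ‖x i - μ‖ ^ 2 + 2 * inner ℝ (x i - μ) (μ - z) + ‖μ - z‖ ^ 2 := fun i => by
    rw [← norm_add_sq_real, sub_add_sub_cancel]
  simp_rw [hpt]
  rw [Finset.sum_add_distrib, Finset.sum_add_distrib, ← Finset.mul_sum, ← sum_inner, hsum]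
  simp

theorem norm_add_sq_le_two_mul {E : Type*} [SeminormedAddCommGroup E] (a b : E) :
    ‖a + b‖ ^ 2 ≤ 2 * ‖a‖ ^ 2 + 2 * ‖b‖ ^ 2 := by
  have h := pow_le_pow_left₀ (norm_nonneg _) (norm_add_le a b) 2
  nlinarith [sq_nonneg (‖a‖ - ‖b‖)]

theorem inf'_norm_sub_le_add {E : Type*} [SeminormedAddCommGroup E] (C : Finset E)
    (hC : C.Nonempty) (z w : E) :
    C.inf' hC (fun c => ‖z - c‖) ≤ C.inf' hC (fun c => ‖w - c‖) + ‖z - w‖ := by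
  obtain ⟨c, hc, hw⟩ := C.exists_mem_eq_inf' hC (fun c => ‖w - c‖)
  rw [hw]
  calc C.inf' hC (fun c => ‖z - c‖) ≤ ‖z - c‖ := Finset.inf'_le _ hc
    _ ≤ ‖z - w‖ + ‖w - c‖ := norm_sub_le_norm_sub_add_norm_sub z w c
    _ = ‖w - c‖ + ‖z - w‖ := add_comm _ _

/-- If `R ^ 2` is a small fraction of the mean of `D i ^ 2`, then the entries of `D` that are
at most `R` force the deviation of `D` from any `t` to be large. -/
theorem card_filter_mul_sq_le {n : ℕ} (hn : 0 < n) (D : Fin n → ℝ) (t : ℝ)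
    (hD : ∀ i, 0 ≤ D i) (ε R : ℝ) (hε0 : 0 < ε) (hε1 : ε ≤ 1)
    (hR : R ^ 2 = (ε ^ 2 / 41) * (∑ i, D i ^ 2) / n) :
    ((Finset.univ.filter fun i => D i ≤ R).card : ℝ) * R ^ 2 ≤
      3 / 34 * ε ^ 2 * ∑ i, (D i - t) ^ 2 := by
  set S := Finset.univ.filter fun i => D i ≤ R
  set T := Finset.univ.filter fun i => ¬ D i ≤ R
  set s : ℝ := (S.card : ℝ)
  have hnpos : (0 : ℝ) < n := by exact_mod_cast hn
  have hsn : s ≤ n := by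
    have h := Finset.card_le_univ S
    rw [Fintype.card_fin] at h
    exact Nat.cast_le.2 h
  have hs0 : 0 ≤ s := Nat.cast_nonneg _
  have hsplit : ∑ i ∈ S, (D i - t) ^ 2 + ∑ i ∈ T, (D i - t) ^ 2 = ∑ i, (D i - t) ^ 2 :=
    Finset.sum_filter_add_sum_filter_not _ _ _
  have hsplitD : ∑ i ∈ S, D i ^ 2 + ∑ i ∈ T, D i ^ 2 = ∑ i, D i ^ 2 :=
    Finset.sum_filter_add_sum_filter_not _ _ _
  have hcard : s + (T.card : ℝ) = n := by
    have h := Finset.card_filter_add_card_filter_not (s := Finset.univ) (fun i => D i ≤ R)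
    rw [Finset.card_univ, Fintype.card_fin] at h
    exact (Nat.cast_add _ _).symm.trans (congrArg Nat.cast h)
  have hVT : 0 ≤ ∑ i ∈ T, (D i - t) ^ 2 := Finset.sum_nonneg fun i _ => sq_nonneg _
  have hVS : 0 ≤ ∑ i ∈ S, (D i - t) ^ 2 := Finset.sum_nonneg fun i _ => sq_nonneg _
  have hDS : ∑ i ∈ S, D i ^ 2 ≤ s * R ^ 2 := by
    rw [← nsmul_eq_mul]
    refine Finset.sum_le_card_nsmul _ _ _ fun i hi => ?_
    exact pow_le_pow_left₀ (hD i) (Finset.mem_filter.1 hi).2 2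
  have hDT : ∑ i ∈ T, D i ^ 2 ≤ T.card * (2 * t ^ 2) + 2 * ∑ i ∈ T, (D i - t) ^ 2 := by
    rw [← nsmul_eq_mul, ← Finset.sum_const, Finset.mul_sum, ← Finset.sum_add_distrib]
    refine Finset.sum_le_sum fun i _ => ?_
    nlinarith [sq_nonneg (D i - 2 * t)]
  have htS : s * t ^ 2 ≤ s * (3 * R ^ 2) + 3 / 2 * ∑ i ∈ S, (D i - t) ^ 2 := by
    rw [← nsmul_eq_mul, ← nsmul_eq_mul, ← Finset.sum_const, ← Finset.sum_const,
      Finset.mul_sum, ← Finset.sum_add_distrib]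
    refine Finset.sum_le_sum fun i hi => ?_
    have hDR := pow_le_pow_left₀ (hD i) (Finset.mem_filter.1 hi).2 2
    nlinarith [sq_nonneg (3 * D i - t)]
  have hΦ : ∑ i, D i ^ 2 ≤ n * (R ^ 2 + 2 * t ^ 2) + 2 * ∑ i ∈ T, (D i - t) ^ 2 := by
    have h₁ : 0 ≤ s * t ^ 2 := by positivity
    have h₂ : 0 ≤ (T.card : ℝ) * R ^ 2 := by positivity
    rw [← hcard]
    linarith
  have hsΦ : s * ∑ i, D i ^ 2 ≤ n * (7 * (s * R ^ 2) + 3 * ∑ i, (D i - t) ^ 2) := by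
    have h₁ := mul_le_mul_of_nonneg_left hΦ hs0
    have h₂ := mul_le_mul_of_nonneg_right hsn hVT
    have h₃ := mul_le_mul_of_nonneg_left htS hnpos.le
    have h₄ := mul_nonneg hnpos.le hVT
    rw [← hsplit]
    linarith
  have hRn : 41 * (n * R ^ 2) = ε ^ 2 * ∑ i, D i ^ 2 := by
    rw [hR]
    field_simp
  have hbound : 41 * (s * R ^ 2) ≤ ε ^ 2 * (7 * (s * R ^ 2) + 3 * ∑ i, (D i - t) ^ 2) := by
    refine le_of_mul_le_mul_left ?_ hnpos
    have h := mul_le_mul_of_nonneg_left hsΦ (sq_nonneg ε)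
    linear_combination h + s * hRn
  have hε : ε ^ 2 ≤ 1 := pow_le_one₀ hε0.le hε1
  have h := mul_le_mul_of_nonneg_right hε (by positivity : 0 ≤ s * R ^ 2)
  linarith

/-- **Case-II lemma: a good center for the collapsed family is a good center for `X`.**
If `y` is obtained from `x` by replacing each point within distance `R` of the center set
`C` by its nearest center, and `m''` is a `(1 + ε/16)`-approximate 1-means center for `y`,
then `∑ ‖x i − m''‖² ≤ (1 + ε/2)·Δ(X)`. -/
theorem stmt_9 {d n : ℕ} (hn : 0 < n)
    (x : Fin n → EuclideanSpace ℝ (Fin d))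
    (C : Finset (EuclideanSpace ℝ (Fin d))) (hC : C.Nonempty)
    (D : EuclideanSpace ℝ (Fin d) → ℝ)
    (hD : ∀ z, D z = C.inf' hC (fun c => ‖z - c‖))
    (ε : ℝ) (hε0 : 0 < ε) (hε1 : ε ≤ 1)
    (R : ℝ) (hR0 : 0 ≤ R)
    (hR : R ^ 2 = (ε ^ 2 / 41) * (∑ i, D (x i) ^ 2) / n)
    (c : Fin n → EuclideanSpace ℝ (Fin d))
    (hc : ∀ i, c i ∈ C ∧ ‖x i - c i‖ = D (x i))
    (y : Fin n → EuclideanSpace ℝ (Fin d))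
    (hy : ∀ i, y i = if D (x i) ≤ R then c i else x i)
    (μ m' : EuclideanSpace ℝ (Fin d))
    (hμ : μ = (n : ℝ)⁻¹ • ∑ i, x i) (hm' : m' = (n : ℝ)⁻¹ • ∑ i, y i)
    (Δ : ℝ) (hΔ : Δ = ∑ i, ‖x i - μ‖ ^ 2)
    (m'' : EuclideanSpace ℝ (Fin d))
    (hgood : ∑ i, ‖y i - m''‖ ^ 2 ≤ (1 + ε / 16) * ∑ i, ‖y i - m'‖ ^ 2) :
    ∑ i, ‖x i - m''‖ ^ 2 ≤ (1 + ε / 2) * Δ := by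
  have hD0 : ∀ z, 0 ≤ D z := fun z => by
    rw [hD]
    exact Finset.le_inf' _ _ fun c _ => norm_nonneg _
  have hLip : ∀ i, (D (x i) - D μ) ^ 2 ≤ ‖x i - μ‖ ^ 2 := fun i => by
    have h₁ := inf'_norm_sub_le_add C hC (x i) μ
    have h₂ := inf'_norm_sub_le_add C hC μ (x i)
    rw [← hD, ← hD] at h₁ h₂
    rw [norm_sub_rev] at h₂
    exact sq_le_sq' (by linarith) (by linarith)
  have hV : ∑ i, (D (x i) - D μ) ^ 2 ≤ Δ := hΔ ▸ Finset.sum_le_sum fun i _ => hLip i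
  have hΔ0 : 0 ≤ Δ := le_trans (Finset.sum_nonneg fun i _ => sq_nonneg _) hV
  have hmove : ∑ i, ‖x i - y i‖ ^ 2 ≤ 3 / 34 * ε ^ 2 * Δ := by
    calc ∑ i, ‖x i - y i‖ ^ 2 ≤ ∑ i, if D (x i) ≤ R then R ^ 2 else 0 := by
          refine Finset.sum_le_sum fun i _ => ?_
          rw [hy]
          split_ifs with h
          · rw [(hc i).2]
            exact pow_le_pow_left₀ (hD0 _) h 2
          · simp
      _ = ((Finset.univ.filter fun i => D (x i) ≤ R).card : ℝ) * R ^ 2 := by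
          rw [← Finset.sum_filter, Finset.sum_const, nsmul_eq_mul]
      _ ≤ 3 / 34 * ε ^ 2 * ∑ i, (D (x i) - D μ) ^ 2 :=
          card_filter_mul_sq_le hn (fun i => D (x i)) (D μ) (fun i => hD0 _) ε R
            hε0 hε1 hR
      _ ≤ 3 / 34 * ε ^ 2 * Δ := by gcongr
  have hx := sum_norm_sub_sq_eq_add_centroid hn x m''
  have hyμ := sum_norm_sub_sq_eq_add_centroid hn y μ
  have hym := sum_norm_sub_sq_eq_add_centroid hn y m''
  have hxy := sum_norm_sub_sq_eq_add_centroid hn (fun i => x i - y i) 0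
  rw [← hμ, ← hΔ] at hx
  rw [← hm'] at hyμ hym
  simp only [sub_zero, Finset.sum_sub_distrib, smul_sub] at hxy
  rw [← hμ, ← hm'] at hxy
  have hcentroids : n * ‖μ - m'‖ ^ 2 ≤ ∑ i, ‖x i - y i‖ ^ 2 := by
    rw [hxy]
    exact le_add_of_nonneg_left (Finset.sum_nonneg fun i _ => sq_nonneg _)
  have hyΔ : ∑ i, ‖y i - μ‖ ^ 2 ≤ 2 * ∑ i, ‖x i - y i‖ ^ 2 + 2 * Δ := by
    rw [hΔ, Finset.mul_sum, Finset.mul_sum, ← Finset.sum_add_distrib]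
    refine Finset.sum_le_sum fun i _ => ?_
    have h := norm_add_sq_le_two_mul (y i - x i) (x i - μ)
    rwa [sub_add_sub_cancel, norm_sub_rev (y i) (x i)] at h
  have hμm' : 0 ≤ n * ‖m' - μ‖ ^ 2 := by positivity
  have hshift : n * ‖μ - m''‖ ^ 2 ≤ 2 * (n * ‖μ - m'‖ ^ 2) + 2 * (n * ‖m' - m''‖ ^ 2) := by
    have h := norm_add_sq_le_two_mul (μ - m') (m' - m'')
    rw [sub_add_sub_cancel] at h
    linarith [mul_le_mul_of_nonneg_left h (Nat.cast_nonneg (α := ℝ) n)]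
  have hεsq : ε ^ 2 * Δ ≤ ε * Δ :=
    mul_le_mul_of_nonneg_right (by nlinarith) hΔ0
  have hεΔ : ε * Δ ≤ Δ := mul_le_of_le_one_left hΔ0 hε1
  have hcost : ε * ∑ i, ‖y i - m'‖ ^ 2 ≤ ε * (37 / 17 * Δ) :=
    mul_le_mul_of_nonneg_left (by linarith) hε0.le
  have hεΔ0 : 0 ≤ ε * Δ := by positivity
  linarith
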